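/- Assume δ ≠ 0. Let O ⊆ {1,…,c} be a set of labels, let p_O = ∑_{i∈O} Pr(i ∈ f_{k'}(X)), and let p̲_O be a real number with 0 < p̲_O ≤ p_O and p̲_O/k' < 1. Define A_O = {w ∈ ℝ^d : δᵀ(w − x) ≤ σ‖δ‖₂ Φ⁻¹(p̲_O/k')}. Then Pr(X ∈ A_O) ≤ (1/k') ∑_{i∈O} Pr(i ∈ f_{k'}(X)) and Pr(Y ∈ A_O) ≤ (1/k') ∑_{i∈O} Pr(i ∈ f_{k'}(Y)). -/

import Mathlib

open MeasureTheory ProbabilityTheory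

/-- Isotropic Gaussian measure `N(m, σ²I)` on `ℝ^d`, as a product of 1-D Gaussians. -/
noncomputable def gaussPi (d : ℕ) (m : Fin d → ℝ) (σ : ℝ) : Measure (Fin d → ℝ) :=
  Measure.pi fun i => gaussianReal (m i) ⟨σ ^ 2, sq_nonneg σ⟩

/-- Standard Gaussian CDF `Φ`. -/
noncomputable def Phi (x : ℝ) : ℝ := (gaussianReal 0 1 (Set.Iic x)).toReal

/-- Inverse of the standard Gaussian CDF, `Φ⁻¹` (genuine inverse on `(0,1)` since `Φ` is a
strictly increasing continuous bijection from `ℝ` onto `(0,1)`). -/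
noncomputable def PhiInv : ℝ → ℝ := Function.invFun Phi

/-- Euclidean dot product `aᵀb` on `ℝ^d`. -/
noncomputable def dotp (d : ℕ) (a b : Fin d → ℝ) : ℝ := ∑ i, a i * b i

/-- Euclidean norm `‖a‖₂` on `ℝ^d`. -/
noncomputable def enorm2 (d : ℕ) (a : Fin d → ℝ) : ℝ := Real.sqrt (∑ i, a i ^ 2)

lemma MeasureTheory.Measure.pi_withDensity_eq_withDensity_prod {ι : Type*} [Fintype ι]
    {α : ι → Type*} [∀ i, MeasurableSpace (α i)] (μ : ∀ i, Measure (α i))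
    [∀ i, IsProbabilityMeasure (μ i)] (g : ∀ i, α i → ENNReal) (hg : ∀ i, Measurable (g i))
    [∀ i, SigmaFinite ((μ i).withDensity (g i))] :
    Measure.pi (fun i => (μ i).withDensity (g i)) =
      (Measure.pi μ).withDensity (fun w => ∏ i, g i (w i)) := by
  refine Measure.pi_eq fun s hs => ?_
  have hind : ∀ i, Measurable ((s i).indicator (g i)) := fun i => (hg i).indicator (hs i)
  have hindep := iIndepFun_pi (μ := μ) (X := fun i => (s i).indicator (g i))
    fun i => (hind i).aemeasurable
  have hprod := lintegral_prod_eq_prod_lintegral_of_indepFun Finset.univ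
    (fun i (w : ∀ i, α i) => (s i).indicator (g i) (w i)) hindep
    (fun i => (hind i).comp (measurable_pi_apply i))
  have hrect : ((Set.univ.pi s).indicator fun w : ∀ i, α i => ∏ i, g i (w i)) =
      fun w => ∏ i, (s i).indicator (g i) (w i) := by
    ext w
    by_cases hw : w ∈ Set.univ.pi s
    · rw [Set.indicator_of_mem hw]
      exact Finset.prod_congr rfl fun i _ => (Set.indicator_of_mem (hw i trivial) _).symm
    · rw [Set.indicator_of_notMem hw]
      obtain ⟨i, hi⟩ : ∃ i, w i ∉ s i := by simpa using hw
      exact (Finset.prod_eq_zero (Finset.mem_univ i) (Set.indicator_of_notMem hi _)).symm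
  rw [withDensity_apply _ (MeasurableSet.univ_pi hs),
    ← lintegral_indicator (MeasurableSet.univ_pi hs), hrect, hprod]
  refine Finset.prod_congr rfl fun i _ => ?_
  rw [withDensity_apply _ (hs i), ← lintegral_indicator (hs i)]
  exact (measurePreserving_eval μ i).lintegral_comp (hind i)

lemma ProbabilityTheory.gaussianReal_add_eq_withDensity (m e : ℝ) {v : NNReal} (hv : v ≠ 0) :
    gaussianReal (m + e) v = (gaussianReal m v).withDensity
      (fun y => ENNReal.ofReal (Real.exp ((e * (y - m) - e ^ 2 / 2) / v))) := by
  rw [gaussianReal_of_var_ne_zero _ hv, gaussianReal_of_var_ne_zero _ hv,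
    ← withDensity_mul _ (measurable_gaussianPDF m v) (by fun_prop)]
  congr 1
  ext y
  have hv' : (v : ℝ) ≠ 0 := by exact_mod_cast hv
  simp only [Pi.mul_apply, gaussianPDF]
  rw [← ENNReal.ofReal_mul (gaussianPDFReal_nonneg _ _ _), gaussianPDFReal, gaussianPDFReal,
    mul_assoc _ (Real.exp _) (Real.exp _), ← Real.exp_add]
  congr 3
  field_simp
  ring

lemma gaussPi_eq_pi_gaussianReal (d : ℕ) (m : Fin d → ℝ) (σ : ℝ) :
    gaussPi d m σ = Measure.pi fun i => gaussianReal (m i) (σ ^ 2).toNNReal := by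
  rw [Real.toNNReal_of_nonneg (sq_nonneg σ)]
  rfl

instance (d : ℕ) (m : Fin d → ℝ) (σ : ℝ) : IsProbabilityMeasure (gaussPi d m σ) := by
  rw [gaussPi_eq_pi_gaussianReal]
  infer_instance

lemma gaussPi_add_eq_withDensity {d : ℕ} (x δ : Fin d → ℝ) {σ : ℝ} (hσ : 0 < σ) :
    gaussPi d (x + δ) σ = (gaussPi d x σ).withDensity (fun w => ENNReal.ofReal
      (Real.exp ((dotp d δ (w - x) - dotp d δ δ / 2) / σ ^ 2))) := by
  have hv : (σ ^ 2).toNNReal ≠ 0 := (Real.toNNReal_pos.mpr (pow_pos hσ 2)).ne'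
  have hshift := fun i => gaussianReal_add_eq_withDensity (x i) (δ i) hv
  rw [Real.coe_toNNReal _ (sq_nonneg σ)] at hshift
  have : ∀ i, SigmaFinite ((gaussianReal (x i) (σ ^ 2).toNNReal).withDensity
      (fun y => ENNReal.ofReal (Real.exp ((δ i * (y - x i) - δ i ^ 2 / 2) / σ ^ 2)))) :=
    fun i => by rw [← hshift]; infer_instance
  simp only [gaussPi_eq_pi_gaussianReal, Pi.add_apply, hshift]
  rw [Measure.pi_withDensity_eq_withDensity_prod _ _ (fun i => by fun_prop)]
  congr 1
  ext w
  rw [← ENNReal.ofReal_prod_of_nonneg fun i _ => (Real.exp_pos _).le, ← Real.exp_sum]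
  congr 2
  simp only [dotp, Pi.sub_apply, ← Finset.sum_div, Finset.sum_sub_distrib, sq]

lemma gaussPi_map_dotp_sub {d : ℕ} (x a : Fin d → ℝ) (σ : ℝ) (ha : σ ^ 2 * dotp d a a = 1) :
    (gaussPi d x σ).map (fun w => dotp d a (w - x)) = gaussianReal 0 1 := by
  have hm : Measurable fun w : Fin d → ℝ => dotp d a (w - x) := by
    unfold dotp; fun_prop
  have hmap : ∀ i, (gaussianReal (x i) (σ ^ 2).toNNReal).map (fun y => a i * (y - x i)) =
      gaussianReal 0 (.mk (a i ^ 2) (sq_nonneg _) * (σ ^ 2).toNNReal) := fun i => by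
    rw [show (fun y => a i * (y - x i)) = (fun z => a i * z) ∘ fun y => y - x i from rfl,
      ← Measure.map_map (by fun_prop) (by fun_prop), gaussianReal_map_sub_const, sub_self, gaussianReal_map_const_mul, mul_zero]
  have : IsProbabilityMeasure ((gaussPi d x σ).map fun w => dotp d a (w - x)) :=
    Measure.isProbabilityMeasure_map hm.aemeasurable
  refine Measure.ext_of_charFun ?_
  ext t
  rw [charFun_apply_real, integral_map hm.aemeasurable (by fun_prop)]
  have hexp : ∀ w : Fin d → ℝ, Complex.exp (t * (dotp d a (w - x) : ℝ) * Complex.I) =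
      ∏ i, Complex.exp (t * ((a i * (w i - x i) : ℝ) : ℂ) * Complex.I) := fun w => by
    rw [← Complex.exp_sum, dotp, Complex.ofReal_sum, Finset.mul_sum, Finset.sum_mul]
    rfl
  simp_rw [hexp]
  rw [gaussPi_eq_pi_gaussianReal, integral_fintype_prod_eq_prod
    (f := fun i y => Complex.exp (t * ((a i * (y - x i) : ℝ) : ℂ) * Complex.I))]
  have hfac : ∀ i, ∫ y, Complex.exp (t * ((a i * (y - x i) : ℝ) : ℂ) * Complex.I)
      ∂gaussianReal (x i) (σ ^ 2).toNNReal =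
      Complex.exp ((-(σ ^ 2 * (a i * a i) * t ^ 2 / 2) : ℝ) : ℂ) := fun i => by
    rw [← integral_map (φ := fun y => a i * (y - x i))
      (f := fun z : ℝ => Complex.exp (t * z * Complex.I)) (by fun_prop) (by fun_prop), hmap,
      ← charFun_apply_real, charFun_gaussianReal]
    rw [NNReal.coe_mul, NNReal.coe_mk, Real.coe_toNNReal _ (sq_nonneg σ)]
    congr 1
    push_cast
    ring
  simp_rw [hfac]
  rw [← Complex.exp_sum, charFun_gaussianReal, ← Complex.ofReal_sum]
  have : ∑ i, -(σ ^ 2 * (a i * a i) * t ^ 2 / 2) = -(t ^ 2 / 2) := by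
    rw [Finset.sum_neg_distrib, ← Finset.sum_div, ← Finset.sum_mul, ← Finset.mul_sum]
    rw [dotp] at ha
    rw [ha, one_mul]
  rw [this]
  congr 1
  push_cast
  simp

lemma Phi_eq_cdf : Phi = cdf (gaussianReal 0 1) := by
  ext y
  rw [cdf_eq_real]
  rfl

lemma continuous_Phi : Continuous Phi := by
  rw [Phi_eq_cdf, continuous_iff_continuousAt]
  intro y
  have := nullSingletonClass_gaussianReal (μ := 0) (v := 1) one_ne_zero
  have h0 := (cdf (gaussianReal 0 1)).measure_singleton y
  rw [measure_cdf, measure_singleton] at h0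
  have h1 := (cdf (gaussianReal 0 1)).mono.leftLim_le (le_refl y)
  have h2 := ENNReal.ofReal_eq_zero.mp h0.symm
  rw [(cdf (gaussianReal 0 1)).mono.continuousAt_iff_leftLim_eq_rightLim,
    StieltjesFunction.rightLim_eq]
  linarith

lemma Phi_PhiInv {p : ℝ} (h0 : 0 < p) (h1 : p < 1) : Phi (PhiInv p) = p := by
  refine Function.invFun_eq (mem_range_of_exists_le_of_exists_ge continuous_Phi ?_ ?_)
  · rw [Phi_eq_cdf]
    exact ((tendsto_cdf_atBot _).eventually (eventually_le_nhds h0)).exists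
  · rw [Phi_eq_cdf]
    exact ((tendsto_cdf_atTop _).eventually (eventually_ge_nhds h1)).exists

/-- The measure, under `N(x, σ²I)`, of a half-space orthogonal to `δ`. -/
lemma gaussPi_halfSpace {d : ℕ} (x : Fin d → ℝ) {δ : Fin d → ℝ} (hδ : δ ≠ 0) {σ : ℝ} (hσ : 0 < σ)
    (q : ℝ) :
    ((gaussPi d x σ) {w | dotp d δ (w - x) ≤ σ * enorm2 d δ * q}).toReal = Phi q := by
  have hpos : 0 < ∑ i, δ i ^ 2 := by
    obtain ⟨i, hi⟩ := Function.ne_iff.mp hδ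
    exact Finset.sum_pos' (fun j _ => sq_nonneg _) ⟨i, Finset.mem_univ i, sq_pos_of_ne_zero hi⟩
  have hs : 0 < σ * enorm2 d δ := mul_pos hσ (Real.sqrt_pos.mpr hpos)
  set s := σ * enorm2 d δ with hsdef
  have hdotp : ∀ w, dotp d (fun i => δ i / s) w = dotp d δ w / s := fun w => by
    simp only [dotp, Finset.sum_div]
    exact Finset.sum_congr rfl fun i _ => by ring
  have hunit : σ ^ 2 * dotp d (fun i => δ i / s) (fun i => δ i / s) = 1 := by
    have hself : dotp d (fun i => δ i / s) (fun i => δ i / s) = (∑ i, δ i ^ 2) / s ^ 2 := by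
      simp only [dotp, Finset.sum_div]
      exact Finset.sum_congr rfl fun i _ => by ring
    rw [hself, hsdef, mul_pow, enorm2, Real.sq_sqrt hpos.le]
    field_simp
  have hm : Measurable fun w : Fin d → ℝ => dotp d (fun i => δ i / s) (w - x) := by
    unfold dotp; fun_prop
  rw [Phi, ← gaussPi_map_dotp_sub x _ σ hunit, Measure.map_apply hm measurableSet_Iic]
  congr 2
  ext w
  simp only [Set.mem_ofPred_eq, Set.mem_preimage, Set.mem_Iic, hdotp, div_le_iff₀ hs, mul_comm q]

/-- Neyman–Pearson lemma for the likelihood-ratio test `A` with threshold `T`. -/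
lemma MeasureTheory.measureReal_le_integral_of_likelihoodRatio {Ω : Type*} [MeasurableSpace Ω]
    {μ ν : Measure Ω} [IsFiniteMeasure μ] [IsFiniteMeasure ν] {g h : Ω → ℝ} {A : Set Ω} {T : ℝ}
    (hg : Measurable g) (hg0 : ∀ w, 0 ≤ g w)
    (hν : ν = μ.withDensity fun w => ENNReal.ofReal (g w))
    (hh : Measurable h) (hh0 : ∀ w, 0 ≤ h w) (hh1 : ∀ w, h w ≤ 1) (hA : MeasurableSet A)
    (hT : 0 ≤ T) (hgA : ∀ w ∈ A, g w ≤ T) (hgAc : ∀ w ∉ A, T ≤ g w)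
    (hμ : μ.real A ≤ ∫ w, h w ∂μ) : ν.real A ≤ ∫ w, h w ∂ν := by
  set r : Ω → ℝ := fun w => h w - A.indicator 1 w
  have hrm : Measurable r := hh.sub (measurable_one.indicator hA)
  have hint : ∀ (κ : Measure Ω) [IsFiniteMeasure κ], Integrable h κ := fun κ _ =>
    Integrable.of_bound hh.aestronglyMeasurable 1
      (.of_forall fun w => by rw [Real.norm_eq_abs, abs_of_nonneg (hh0 w)]; exact hh1 w)
  have hintA : ∀ (κ : Measure Ω) [IsFiniteMeasure κ], Integrable (A.indicator (1 : Ω → ℝ)) κ :=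
    fun κ _ => (integrable_const (1 : ℝ)).indicator hA
  have hr : ∀ (κ : Measure Ω) [IsFiniteMeasure κ], ∫ w, r w ∂κ = ∫ w, h w ∂κ - κ.real A :=
    fun κ _ => by
      rw [integral_sub (hint κ) (hintA κ), integral_indicator_one hA]
  have hdens : ∫ w, r w ∂ν = ∫ w, g w * r w ∂μ := by
    rw [hν, integral_withDensity_eq_integral_toReal_smul (by fun_prop) (by simp)]
    simp [ENNReal.toReal_ofReal (hg0 _)]
  have hgr : Integrable (fun w => g w * r w) μ := by
    have : Integrable r ν := (hint ν).sub (hintA ν)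
    rw [hν, integrable_withDensity_iff_integrable_smul' (by fun_prop) (by simp)] at this
    simpa [ENNReal.toReal_ofReal (hg0 _)] using this
  have hmono : ∫ w, T * r w ∂μ ≤ ∫ w, g w * r w ∂μ := by
    refine integral_mono (((hint μ).sub (hintA μ)).const_mul T) hgr fun w => ?_
    by_cases hw : w ∈ A
    · have : r w ≤ 0 := by simp [r, hw, hh1 w]
      exact mul_le_mul_of_nonpos_right (hgA w hw) this
    · have : 0 ≤ r w := by simp [r, hw, hh0 w]
      exact mul_le_mul_of_nonneg_right (hgAc w hw) this
  rw [integral_const_mul, hr μ, ← hdens, hr ν] at hmono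
  linarith [mul_nonneg hT (sub_nonneg.mpr hμ)]

/-- Lemma 5 (first halves), for a set `O` of labels: with `p̲_O ≤ p_O = ∑_{i∈O} Pr(i ∈ f_{k'}(X))`,
`0 < p̲_O`, `p̲_O/k' < 1`, and `A_O = {w | δᵀ(w−x) ≤ σ‖δ‖₂ Φ⁻¹(p̲_O/k')}`, we have
`Pr(X ∈ A_O) ≤ (1/k') ∑_{i∈O} Pr(i ∈ f_{k'}(X))` and
`Pr(Y ∈ A_O) ≤ (1/k') ∑_{i∈O} Pr(i ∈ f_{k'}(Y))`, where `X ~ N(x,σ²I)`, `Y ~ N(x+δ,σ²I)`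
and the base classifier `f` outputs exactly `k'` labels from `{1,…,c}`. -/
theorem stmt8 {d : ℕ} (c k' : ℕ) (hk' : 1 ≤ k')
    (x δ : Fin d → ℝ) (hδ : δ ≠ 0) (σ : ℝ) (hσ : 0 < σ)
    (f : (Fin d → ℝ) → Finset (Fin c)) (hfcard : ∀ w, (f w).card = k')
    (hfm : ∀ i : Fin c, MeasurableSet {w : Fin d → ℝ | i ∈ f w})
    (O : Finset (Fin c)) (pOlow : ℝ) (hlow0 : 0 < pOlow)
    (hlow : pOlow ≤ ∑ i ∈ O, ((gaussPi d x σ) {w | i ∈ f w}).toReal)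
    (hlt : pOlow / (k' : ℝ) < 1)
    (A : Set (Fin d → ℝ))
    (hA : A = {w | dotp d δ (w - x) ≤ σ * enorm2 d δ * PhiInv (pOlow / (k' : ℝ))}) :
    ((gaussPi d x σ) A).toReal ≤
        (1 / (k' : ℝ)) * ∑ i ∈ O, ((gaussPi d x σ) {w | i ∈ f w}).toReal ∧
    ((gaussPi d (x + δ) σ) A).toReal ≤
        (1 / (k' : ℝ)) * ∑ i ∈ O, ((gaussPi d (x + δ) σ) {w | i ∈ f w}).toReal := by
  have hk : (0 : ℝ) < k' := by exact_mod_cast hk'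
  set h : (Fin d → ℝ) → ℝ := fun w =>
    (1 / (k' : ℝ)) * ∑ i ∈ O, {w : Fin d → ℝ | i ∈ f w}.indicator 1 w with hh
  have hone : ∀ i, Measurable ({w : Fin d → ℝ | i ∈ f w}.indicator (1 : (Fin d → ℝ) → ℝ)) :=
    fun i => measurable_one.indicator (hfm i)
  have hmeas : Measurable h := (Finset.measurable_sum O fun i _ => hone i).const_mul _
  have hh0 : ∀ w, 0 ≤ h w := fun w => mul_nonneg (by positivity)
    (Finset.sum_nonneg fun i _ => Set.indicator_nonneg (fun _ _ => zero_le_one) w)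
  have hh1 : ∀ w, h w ≤ 1 := fun w => by
    have hcard : ∑ i ∈ O, {w : Fin d → ℝ | i ∈ f w}.indicator (1 : (Fin d → ℝ) → ℝ) w =
        ((O.filter (· ∈ f w)).card : ℝ) := by
      simp [Set.indicator_apply, Finset.filter_mem_eq_inter]
    have hle : (O.filter (· ∈ f w)).card ≤ k' := by
      rw [← hfcard w]
      exact Finset.card_le_card fun i hi => (Finset.mem_filter.mp hi).2
    rw [hh]
    simp only [hcard]
    rw [one_div_mul_eq_div, div_le_one hk]
    exact_mod_cast hle
  have hint : ∀ (κ : Measure (Fin d → ℝ)) [IsFiniteMeasure κ],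
      ∫ w, h w ∂κ = (1 / (k' : ℝ)) * ∑ i ∈ O, (κ {w | i ∈ f w}).toReal := fun κ _ => by
    have hone_int : ∀ i ∈ O,
        Integrable ({w : Fin d → ℝ | i ∈ f w}.indicator (1 : (Fin d → ℝ) → ℝ)) κ :=
      fun i _ => (integrable_const (1 : ℝ)).indicator (hfm i)
    rw [integral_const_mul, integral_finsetSum _ hone_int]
    congr 1
    exact Finset.sum_congr rfl fun i _ => integral_indicator_one (hfm i)
  have hX : ((gaussPi d x σ) A).toReal ≤
      (1 / (k' : ℝ)) * ∑ i ∈ O, ((gaussPi d x σ) {w | i ∈ f w}).toReal := by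
    rw [hA, gaussPi_halfSpace x hδ hσ, Phi_PhiInv (div_pos hlow0 hk) hlt, div_eq_inv_mul,
      one_div]
    exact mul_le_mul_of_nonneg_left hlow (by positivity)
  have hdm : Measurable fun w : Fin d → ℝ => dotp d δ (w - x) := by
    unfold dotp; fun_prop
  refine ⟨hX, ?_⟩
  rw [← hint] at hX ⊢
  refine measureReal_le_integral_of_likelihoodRatio (by fun_prop) (fun w => (Real.exp_pos _).le)
    (gaussPi_add_eq_withDensity x δ hσ) hmeas hh0 hh1 ?_
    (T := Real.exp ((σ * enorm2 d δ * PhiInv (pOlow / k') - dotp d δ δ / 2) / σ ^ 2))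
    (Real.exp_pos _).le ?_ ?_ hX
  · rw [hA]
    exact measurableSet_le hdm measurable_const
  · intro w hw
    rw [hA, Set.mem_ofPred_eq] at hw
    gcongr
  · intro w hw
    rw [hA, Set.mem_ofPred_eq, not_le] at hw
    gcongr
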